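/- A permutation w in the symmetric group S_n is 321-avoiding (there are no indices i1 < i2 < i3 with w(i1) > w(i2) > w(i3)) if and only if no reduced word for w (as a word in the adjacent transpositions s_1,...,s_{n-1}) contains three consecutive letters of the form s_i, s_{i±1}, s_i. -/

import Mathlib

open Polynomial

/-- The simple transposition `s_i = (i, i+1)` (1-based) in `S_n`, acting on `Fin n`
(0-based positions `i-1` and `i`); equals `1` if `i` is out of range. -/
def gen (n : ℕ) (i : ℕ) : Equiv.Perm (Fin n) :=
  if h : 1 ≤ i ∧ i < n then Equiv.swap ⟨i - 1, by omega⟩ ⟨i, h.2⟩ else 1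

/-- Product of the word `l` of generator indices. -/
def wordProd (n : ℕ) (l : List ℕ) : Equiv.Perm (Fin n) :=
  (l.map (gen n)).prod

/-- Coxeter length of `w ∈ S_n`. -/
noncomputable def len (n : ℕ) (w : Equiv.Perm (Fin n)) : ℕ :=
  sInf {r | ∃ l : List ℕ, (∀ i ∈ l, 1 ≤ i ∧ i < n) ∧ wordProd n l = w ∧ l.length = r}

/-- `l` is a reduced word for `w`. -/
def IsReducedWord (n : ℕ) (w : Equiv.Perm (Fin n)) (l : List ℕ) : Prop :=
  (∀ i ∈ l, 1 ≤ i ∧ i < n) ∧ wordProd n l = w ∧ l.length = len n w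

/-- Bruhat-Chevalley order: `x ≤ w` iff every reduced word for `w` contains a
subword whose product is `x`. -/
def Bruhat (n : ℕ) (x w : Equiv.Perm (Fin n)) : Prop :=
  ∀ l, IsReducedWord n w l → ∃ t, t.Sublist l ∧ wordProd n t = x

/-- `w` is 321-avoiding: no `i < j < k` with `w i > w j > w k`. -/
def Avoids321 (n : ℕ) (w : Equiv.Perm (Fin n)) : Prop :=
  ¬ ∃ i j k : Fin n, i < j ∧ j < k ∧ w j < w i ∧ w k < w j

/-- Product of the subword of `l` selected by the mask `S` (set of selected positions). -/
def maskProd (n : ℕ) (l : List ℕ) (S : Finset ℕ) : Equiv.Perm (Fin n) :=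
  wordProd n (((List.range l.length).filter (fun j => decide (j ∈ S))).map (fun j => l.getD j 0))

/-- Position `j` of the word `l` is a defect of the mask `S`. -/
noncomputable def IsDefect (n : ℕ) (l : List ℕ) (S : Finset ℕ) (j : ℕ) : Prop :=
  len n (maskProd n (l.take j) S * gen n (l.getD j 0)) < len n (maskProd n (l.take j) S)

/-- The defect set `D(σ)` of the mask `S` on the word `l`. -/
noncomputable def defectSet (n : ℕ) (l : List ℕ) (S : Finset ℕ) : Finset ℕ :=
  (Finset.range l.length).filter (fun j =>
    len n (maskProd n (l.take j) S * gen n (l.getD j 0)) < len n (maskProd n (l.take j) S))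

/-- Deodhar's defect generating polynomial `P_x(a) = Σ_{σ : π(w^σ) = x} q^{|D(σ)|}`. -/
noncomputable def defPoly (n : ℕ) (l : List ℕ) (x : Equiv.Perm (Fin n)) : Polynomial ℤ :=
  ∑ S ∈ (Finset.range l.length).powerset,
    if maskProd n l S = x then (X : Polynomial ℤ) ^ (defectSet n l S).card else 0


/-- inversion set -/
def invSet (n : ℕ) (w : Equiv.Perm (Fin n)) : Finset (Fin n × Fin n) :=
  Finset.univ.filter (fun x => x.1 < x.2 ∧ w x.2 < w x.1)

theorem mem_invSet {n : ℕ} (w : Equiv.Perm (Fin n)) (i j : Fin n) :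
    (i, j) ∈ invSet n w ↔ i < j ∧ w j < w i := by
  simp [invSet]

def inv321 (n : ℕ) (w : Equiv.Perm (Fin n)) : ℕ := (invSet n w).card

theorem swap_lt_iff {n : ℕ} (p q i j : Fin n) (hpq : p.val + 1 = q.val)
    (h1 : ¬ (i = p ∧ j = q)) (h2 : ¬ (i = q ∧ j = p)) :
    Equiv.swap p q i < Equiv.swap p q j ↔ i < j := by
  simp only [Equiv.swap_apply_def, Fin.ext_iff, Fin.lt_def] at *
  split_ifs <;> omega

theorem inv_asc {n : ℕ} (w : Equiv.Perm (Fin n)) (p q : Fin n) (hpq : p.val + 1 = q.val)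
    (h : w p < w q) : inv321 n (w * Equiv.swap p q) = inv321 n w + 1 := by
  have key : invSet n (w * Equiv.swap p q) =
      insert (p, q) ((invSet n w).map
        (Equiv.prodCongr (Equiv.swap p q) (Equiv.swap p q)).toEmbedding) := by
    ext ⟨i, j⟩
    rw [Finset.mem_insert, Finset.mem_map_equiv]
    simp only [mem_invSet, Equiv.Perm.mul_apply,
      Equiv.prodCongr_symm, Equiv.symm_swap, Equiv.prodCongr_apply, Prod.map, Prod.mk.injEq]
    have hpq' : p < q := by rw [Fin.lt_def]; omega
    by_cases h1 : i = p ∧ j = q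
    · obtain ⟨rfl, rfl⟩ := h1
      simp [hpq', h]
    · by_cases h2 : i = q ∧ j = p
      · obtain ⟨rfl, rfl⟩ := h2
        simp [hpq'.not_gt, h.not_gt, hpq'.ne']
      · simp [h1, swap_lt_iff p q i j hpq h1 h2]
  unfold inv321
  rw [key, Finset.card_insert_of_notMem, Finset.card_map]
  rw [Finset.mem_map_equiv]
  simp [mem_invSet]
  intro h'
  rw [Fin.lt_def] at h'
  omega

theorem inv_desc {n : ℕ} (w : Equiv.Perm (Fin n)) (p q : Fin n) (hpq : p.val + 1 = q.val)
    (h : w q < w p) : inv321 n (w * Equiv.swap p q) + 1 = inv321 n w := by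
  have := inv_asc (w * Equiv.swap p q) p q hpq (by simpa using h)
  rw [← this, mul_assoc, Equiv.swap_mul_self, mul_one]

theorem gen_eq {n : ℕ} (p q : Fin n) (hpq : p.val + 1 = q.val) :
    gen n q.val = Equiv.swap p q := by
  have hq := q.2
  rw [gen, dif_pos ⟨by omega, hq⟩]
  congr 1
  ext; simp; omega

theorem gen_ex {n i : ℕ} (h : 1 ≤ i ∧ i < n) :
    ∃ p q : Fin n, p.val + 1 = q.val ∧ q.val = i ∧ gen n i = Equiv.swap p q :=
  ⟨⟨i - 1, by omega⟩, ⟨i, h.2⟩, by simp; omega, rfl, by rw [gen, dif_pos h]⟩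

theorem inv_le {n i : ℕ} (w : Equiv.Perm (Fin n)) (h : 1 ≤ i ∧ i < n) :
    inv321 n (w * gen n i) ≤ inv321 n w + 1 := by
  obtain ⟨p, q, hpq, -, e⟩ := gen_ex h
  rw [e]
  rcases lt_trichotomy (w p) (w q) with h1 | h1 | h1
  · exact (inv_asc w p q hpq h1).le
  · have := w.injective h1
    rw [this] at hpq; omega
  · have := inv_desc w p q hpq h1
    omega

theorem asc_of_inv {n : ℕ} (w : Equiv.Perm (Fin n)) (p q : Fin n) (hpq : p.val + 1 = q.val)
    (h : inv321 n (w * Equiv.swap p q) = inv321 n w + 1) : w p < w q := by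
  rcases lt_trichotomy (w p) (w q) with h1 | h1 | h1
  · exact h1
  · have := w.injective h1
    rw [this] at hpq; omega
  · have := inv_desc w p q hpq h1
    omega

theorem wordProd_append (n : ℕ) (a b : List ℕ) :
    wordProd n (a ++ b) = wordProd n a * wordProd n b := by
  simp [wordProd]

theorem wordProd_single (n i : ℕ) : wordProd n [i] = gen n i := by
  simp [wordProd]

theorem inv321_one (n : ℕ) : inv321 n 1 = 0 := by
  unfold inv321 invSet
  rw [Finset.card_eq_zero, Finset.filter_eq_empty_iff]
  rintro ⟨i, j⟩ - ⟨h1, h2⟩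
  exact lt_asymm h1 h2

theorem inv_append_le (n : ℕ) (a b : List ℕ) (hb : ∀ i ∈ b, 1 ≤ i ∧ i < n) :
    inv321 n (wordProd n (a ++ b)) ≤ inv321 n (wordProd n a) + b.length := by
  induction b using List.reverseRecOn with
  | nil => simp
  | append_singleton b m ih =>
    rw [← List.append_assoc, wordProd_append n (a ++ b), wordProd_single]
    have h1 := inv_le (wordProd n (a ++ b)) (hb m (by simp))
    have h2 := ih (fun i hi => hb i (by simp [hi]))
    simp only [List.length_append, List.length_singleton]
    omega

theorem inv_word_le (n : ℕ) (b : List ℕ) (hb : ∀ i ∈ b, 1 ≤ i ∧ i < n) :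
    inv321 n (wordProd n b) ≤ b.length := by
  have := inv_append_le n [] b hb
  simpa [wordProd, inv321_one] using this

theorem exists_desc {n : ℕ} (w : Equiv.Perm (Fin n)) (hw : w ≠ 1) :
    ∃ p q : Fin n, p.val + 1 = q.val ∧ w q < w p := by
  by_contra hc
  push Not at hc
  apply hw
  have hm : StrictMono w := by
    cases n with
    | zero => intro i; exact i.elim0
    | succ n =>
      rw [Fin.strictMono_iff_lt_succ]
      intro i
      have := hc i.castSucc i.succ (by simp)
      refine lt_of_le_of_ne this fun h => ?_
      have := w.injective h
      simp [Fin.ext_iff] at this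
  ext i
  have := Subsingleton.elim (hm.orderIsoOfSurjective w w.surjective) (OrderIso.refl _)
  have := congrArg (fun f => f i) this
  simpa using congrArg Fin.val this

theorem exists_word (n : ℕ) (k : ℕ) : ∀ w : Equiv.Perm (Fin n), inv321 n w = k →
    ∃ l : List ℕ, (∀ i ∈ l, 1 ≤ i ∧ i < n) ∧ wordProd n l = w ∧ l.length = k := by
  induction k with
  | zero =>
    intro w hw
    refine ⟨[], by simp, ?_, rfl⟩
    by_contra hne
    obtain ⟨p, q, hpq, h⟩ := exists_desc w (fun h => hne (by simp [wordProd, h]))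
    have := inv_desc w p q hpq h
    omega
  | succ k ih =>
    intro w hw
    have hne : w ≠ 1 := by
      rintro rfl
      rw [inv321_one] at hw; omega
    obtain ⟨p, q, hpq, h⟩ := exists_desc w hne
    have := inv_desc w p q hpq h
    obtain ⟨l, h1, h2, h3⟩ := ih (w * Equiv.swap p q) (by omega)
    refine ⟨l ++ [q.val], ?_, ?_, by simp [h3]⟩
    · intro i hi
      rcases List.mem_append.1 hi with hi | hi
      · exact h1 i hi
      · have := q.2
        simp at hi
        omega
    · rw [wordProd_append, wordProd_single, gen_eq p q hpq, h2, mul_assoc,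
        Equiv.swap_mul_self, mul_one]

theorem len_eq (n : ℕ) (w : Equiv.Perm (Fin n)) : len n w = inv321 n w := by
  have hm := exists_word n _ w rfl
  apply le_antisymm
  · exact Nat.sInf_le hm
  · refine le_csInf ⟨_, hm⟩ ?_
    rintro r ⟨l, h1, h2, h3⟩
    rw [← h2, ← h3]
    exact inv_word_le n l h1

def Has321 (n : ℕ) (w : Equiv.Perm (Fin n)) : Prop :=
  ∃ i j k : Fin n, i < j ∧ j < k ∧ w j < w i ∧ w k < w j

theorem has_asc {n : ℕ} (w : Equiv.Perm (Fin n)) (p q : Fin n) (hpq : p.val + 1 = q.val)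
    (h : w p < w q) (hw : Has321 n w) : Has321 n (w * Equiv.swap p q) := by
  obtain ⟨i, j, k, hij, hjk, h1, h2⟩ := hw
  have hpq' : p < q := by rw [Fin.lt_def]; omega
  have aux : ∀ i j : Fin n, i < j → w j < w i → Equiv.swap p q i < Equiv.swap p q j := by
    intro i j hij hw
    rw [swap_lt_iff p q i j hpq]
    · exact hij
    · rintro ⟨rfl, rfl⟩; exact lt_asymm h hw
    · rintro ⟨rfl, rfl⟩; exact lt_asymm hpq' hij
  refine ⟨Equiv.swap p q i, Equiv.swap p q j, Equiv.swap p q k, aux _ _ hij h1, aux _ _ hjk h2,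
    ?_, ?_⟩ <;> simpa using by assumption

theorem has_append (n : ℕ) (a b : List ℕ) (hb : ∀ i ∈ b, 1 ≤ i ∧ i < n)
    (hr : inv321 n (wordProd n (a ++ b)) = inv321 n (wordProd n a) + b.length)
    (ha : Has321 n (wordProd n a)) : Has321 n (wordProd n (a ++ b)) := by
  induction b using List.reverseRecOn with
  | nil => simpa using ha
  | append_singleton b m ih =>
    have hb' : ∀ i ∈ b, 1 ≤ i ∧ i < n := fun i hi => hb i (by simp [hi])
    have hm := hb m (by simp)
    have h1 := inv_le (wordProd n (a ++ b)) hm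
    have h2 := inv_append_le n a b hb'
    rw [← List.append_assoc, wordProd_append n (a ++ b), wordProd_single] at hr ⊢
    simp only [List.length_append, List.length_singleton] at hr
    have h3 := ih hb' (by omega)
    obtain ⟨p, q, hpq, -, e⟩ := gen_ex hm
    rw [e] at hr h1 ⊢
    exact has_asc _ p q hpq (asc_of_inv _ p q hpq (by omega)) h3

theorem has_braid {n : ℕ} (x : Equiv.Perm (Fin n)) (i i' : ℕ) (hi : 1 ≤ i ∧ i < n)
    (hi' : 1 ≤ i' ∧ i' < n) (hii : i' = i + 1 ∨ i' + 1 = i)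
    (h : inv321 n (x * gen n i * gen n i' * gen n i) = inv321 n x + 3) :
    Has321 n (x * gen n i * gen n i' * gen n i) := by
  have e1 := inv_le x hi
  have e2 := inv_le (x * gen n i) hi'
  have e3 := inv_le (x * gen n i * gen n i') hi
  have f1 : inv321 n (x * gen n i) = inv321 n x + 1 := by omega
  have f2 : inv321 n (x * gen n i * gen n i') = inv321 n (x * gen n i) + 1 := by omega
  have f3 : inv321 n (x * gen n i * gen n i' * gen n i)
    = inv321 n (x * gen n i * gen n i') + 1 := by omega
  clear h e1 e2 e3
  rcases hii with rfl | rfl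
  · let p : Fin n := ⟨i - 1, by omega⟩
    let q : Fin n := ⟨i, by omega⟩
    let r : Fin n := ⟨i + 1, by omega⟩
    have hpq : p.val + 1 = q.val := by simp [p, q]; omega
    have hqr : q.val + 1 = r.val := by simp [q, r]
    have g1 : gen n i = Equiv.swap p q := gen_eq p q hpq
    have g2 : gen n (i+1) = Equiv.swap q r := gen_eq q r hqr
    rw [g1] at f1 f2 f3 ⊢
    rw [g2] at f2 f3 ⊢
    have a1 := asc_of_inv _ _ _ hpq f1
    have a2 := asc_of_inv _ _ _ hqr f2
    have a3 := asc_of_inv _ _ _ hpq f3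
    have n1 : p ≠ q := by intro h; rw [h] at hpq; omega
    have n2 : q ≠ r := by intro h; rw [h] at hqr; omega
    have n3 : p ≠ r := by intro h; rw [h] at hpq; omega
    clear_value p q r
    refine ⟨p, q, r, by rw [Fin.lt_def]; omega, by rw [Fin.lt_def]; omega, ?_, ?_⟩ <;>
    simp_all [Equiv.swap_apply_of_ne_of_ne, Ne.symm]
  · let p : Fin n := ⟨i' - 1, by omega⟩
    let q : Fin n := ⟨i', by omega⟩
    let r : Fin n := ⟨i' + 1, by omega⟩
    have hpq : p.val + 1 = q.val := by simp [p, q]; omega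
    have hqr : q.val + 1 = r.val := by simp [q, r]
    have g1 : gen n i' = Equiv.swap p q := gen_eq p q hpq
    have g2 : gen n (i'+1) = Equiv.swap q r := gen_eq q r hqr
    rw [g2] at f1 f2 f3 ⊢
    rw [g1] at f2 f3 ⊢
    have a1 := asc_of_inv _ _ _ hqr f1
    have a2 := asc_of_inv _ _ _ hpq f2
    have a3 := asc_of_inv _ _ _ hqr f3
    have n1 : p ≠ q := by intro h; rw [h] at hpq; omega
    have n2 : q ≠ r := by intro h; rw [h] at hqr; omega
    have n3 : p ≠ r := by intro h; rw [h] at hpq; omega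
    clear_value p q r
    refine ⟨p, q, r, by rw [Fin.lt_def]; omega, by rw [Fin.lt_def]; omega, ?_, ?_⟩ <;>
    simp_all [Equiv.swap_apply_of_ne_of_ne, Ne.symm]

theorem list_split (l : List ℕ) (j : ℕ) (h : j + 2 < l.length) :
    l = (l.take j ++ [l.getD j 0, l.getD (j+1) 0, l.getD (j+2) 0]) ++ l.drop (j+3) := by
  conv_lhs => rw [← List.take_append_drop j l, List.drop_eq_getElem_cons (by omega),
    List.drop_eq_getElem_cons (by omega), List.drop_eq_getElem_cons (by omega)]
  rw [List.getD_eq_getElem _ _ (by omega), List.getD_eq_getElem _ _ (by omega),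
    List.getD_eq_getElem _ _ (by omega)]
  simp

theorem braid_has (n : ℕ) (a b : List ℕ) (i i' : ℕ)
    (hv : ∀ m ∈ (a ++ [i, i', i]) ++ b, 1 ≤ m ∧ m < n)
    (hii : i' = i + 1 ∨ i' + 1 = i)
    (hr : inv321 n (wordProd n ((a ++ [i, i', i]) ++ b)) = ((a ++ [i, i', i]) ++ b).length) :
    Has321 n (wordProd n ((a ++ [i, i', i]) ++ b)) := by
  have va : ∀ m ∈ a, 1 ≤ m ∧ m < n := fun m hm => hv m (by simp [hm])
  have vc : ∀ m ∈ [i, i', i], 1 ≤ m ∧ m < n := fun m hm => hv m (by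
    rw [List.mem_append, List.mem_append]; exact Or.inl (Or.inr hm))
  have vb : ∀ m ∈ b, 1 ≤ m ∧ m < n := fun m hm => hv m (by simp [hm])
  have h1 := inv_append_le n (a ++ [i, i', i]) b vb
  have h2 := inv_append_le n a _ vc
  have h3 := inv_word_le n a va
  rw [List.length_append, List.length_append] at hr
  apply has_append n _ _ vb (by omega)
  have e : wordProd n (a ++ [i, i', i]) = wordProd n a * gen n i * gen n i' * gen n i := by
    simp [wordProd, mul_assoc]
  simp only [List.length_cons, List.length_nil] at h2 hr
  rw [e] at h1 h2 ⊢
  exact has_braid _ _ _ (vc i (by simp)) (vc i' (by simp)) hii (by omega)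

def HasBraidWord (n : ℕ) (w : Equiv.Perm (Fin n)) : Prop :=
  ∃ a b : List ℕ, ∃ i i' : ℕ, (∀ m ∈ (a ++ [i, i', i]) ++ b, 1 ≤ m ∧ m < n) ∧
    (i' = i + 1 ∨ i' + 1 = i) ∧ wordProd n ((a ++ [i, i', i]) ++ b) = w ∧
    ((a ++ [i, i', i]) ++ b).length = inv321 n w

theorem hbw_desc {n : ℕ} (w : Equiv.Perm (Fin n)) (p q : Fin n) (hpq : p.val + 1 = q.val)
    (h : w q < w p) (H : HasBraidWord n (w * Equiv.swap p q)) : HasBraidWord n w := by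
  obtain ⟨a, b, i, i', hv, hii, hp, hl⟩ := H
  have := inv_desc w p q hpq h
  refine ⟨a, b ++ [q.val], i, i', ?_, hii, ?_, ?_⟩
  · intro m hm
    rw [← List.append_assoc, List.mem_append] at hm
    rcases hm with hm | hm
    · exact hv m hm
    · have := q.2
      simp at hm
      omega
  · rw [← List.append_assoc, wordProd_append, wordProd_single, gen_eq p q hpq, hp, mul_assoc,
        Equiv.swap_mul_self, mul_one]
  · rw [← List.append_assoc, List.length_append, hl]
    simpa using this

theorem has_hbw (n : ℕ) (N : ℕ) : ∀ (w : Equiv.Perm (Fin n)) (i j k : Fin n),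
    i < j → j < k → w j < w i → w k < w j → inv321 n w + (k.val - i.val) ≤ N →
    HasBraidWord n w := by
  induction N with
  | zero =>
    intro w i j k hij hjk h1 h2 hN
    rw [Fin.lt_def] at hij hjk
    omega
  | succ N ih =>
    intro w i j k hij hjk h1 h2 hN
    have hij' := Fin.lt_def.1 hij
    have hjk' := Fin.lt_def.1 hjk
    by_cases c1 : i.val + 1 = j.val
    · by_cases c2 : j.val + 1 = k.val
      · -- consecutive
        have n1 : i ≠ j := hij.ne
        have n2 : j ≠ k := hjk.ne
        have n3 : i ≠ k := (hij.trans hjk).ne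
        have d1 := inv_desc w i j c1 h1
        have d2 := inv_desc (w * Equiv.swap i j) j k c2 (by
          simpa [Equiv.swap_apply_of_ne_of_ne n3.symm n2.symm] using h2.trans h1)
        have d3 := inv_desc (w * Equiv.swap i j * Equiv.swap j k) i j c1 (by
          simpa [Equiv.swap_apply_of_ne_of_ne n3.symm n2.symm,
            Equiv.swap_apply_of_ne_of_ne n1 n3] using h2)
        obtain ⟨l, l1, l2, l3⟩ := exists_word n _
          (w * Equiv.swap i j * Equiv.swap j k * Equiv.swap i j) rfl
        refine ⟨l, [], j.val, k.val, ?_, Or.inl c2.symm, ?_, ?_⟩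
        · intro m hm
          have := k.2
          have := j.2
          simp at hm
          rcases hm with hm | hm | hm
          · exact l1 m hm
          · omega
          · omega
        · have : wordProd n [j.val, k.val, j.val] =
              Equiv.swap i j * (Equiv.swap j k * Equiv.swap i j) := by
            simp [wordProd, gen_eq i j c1, gen_eq j k c2]
          rw [List.append_nil, wordProd_append, l2, this]
          simp [mul_assoc]
        · simp
          omega
      · let k' : Fin n := ⟨k.val - 1, by have := k.2; omega⟩
        have hk : k'.val + 1 = k.val := by simp [k']; omega
        have hjk2 : j < k' := by rw [Fin.lt_def]; omega
        clear_value k'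
        rcases lt_trichotomy (w k') (w j) with h | h | h
        · exact ih w i j k' hij hjk2 h1 h (by omega)
        · exact absurd (w.injective h) hjk2.ne'
        · have hd := h2.trans h
          apply hbw_desc w k' k hk hd
          have := inv_desc w k' k hk hd
          have m1 : i ≠ k' := (hij.trans hjk2).ne
          have m2 : i ≠ k := (hij.trans hjk).ne
          refine ih _ i j k' hij hjk2 ?_ ?_ (by omega)
          · simpa [Equiv.swap_apply_of_ne_of_ne m1 m2,
              Equiv.swap_apply_of_ne_of_ne hjk2.ne hjk.ne] using h1
          · simpa [Equiv.swap_apply_of_ne_of_ne hjk2.ne hjk.ne] using h2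
    · let i' : Fin n := ⟨i.val + 1, by have := j.2; omega⟩
      have hi : i.val + 1 = i'.val := rfl
      have hij2 : i' < j := by rw [Fin.lt_def]; omega
      clear_value i'
      rcases lt_trichotomy (w i') (w j) with h | h | h
      · have hd := h.trans h1
        apply hbw_desc w i i' hi hd
        have := inv_desc w i i' hi hd
        have m1 : k ≠ i' := (hij2.trans hjk).ne'
        have m2 : k ≠ i := (hij.trans hjk).ne'
        refine ih _ i' j k hij2 hjk ?_ ?_ (by omega)
        · simpa [Equiv.swap_apply_of_ne_of_ne hij.ne' hij2.ne'] using h1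
        · simpa [Equiv.swap_apply_of_ne_of_ne m2 m1,
            Equiv.swap_apply_of_ne_of_ne hij.ne' hij2.ne'] using h2
      · exact absurd (w.injective h) hij2.ne
      · exact ih w i' j k hij2 hjk h h2 (by omega)

/-- `w ∈ S_n` is 321-avoiding iff no reduced word for `w` contains a
consecutive substring `s_i s_{i±1} s_i`. -/
theorem stmt0 (n : ℕ) (w : Equiv.Perm (Fin n)) :
    Avoids321 n w ↔
      ∀ l, IsReducedWord n w l →
        ¬ ∃ j, j + 2 < l.length ∧ l.getD j 0 = l.getD (j + 2) 0 ∧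
          (l.getD (j + 1) 0 = l.getD j 0 + 1 ∨ l.getD (j + 1) 0 + 1 = l.getD j 0) := by
  constructor
  · rintro hw l ⟨hv, hp, hl⟩ ⟨j, hj, h1, h2⟩
    apply hw
    have hs := list_split l j hj
    rw [← h1] at hs
    rw [len_eq, ← hp] at hl
    change Has321 n w
    rw [← hp]
    generalize l.getD j 0 = i at *
    generalize l.getD (j+1) 0 = i' at *
    generalize l.take j = a at *
    generalize l.drop (j+3) = b at *
    subst hs
    exact braid_has n a b i i' hv h2 hl.symm
  · rintro H ⟨i, j, k, hij, hjk, h1, h2⟩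
    obtain ⟨a, b, i, i', hv, hii, hp, hl⟩ := has_hbw n _ w i j k hij hjk h1 h2 le_rfl
    refine H _ ⟨hv, hp, by rw [len_eq, hl]⟩ ⟨a.length, by simp, ?_, ?_⟩
    · simp [List.getD_eq_getElem?_getD]
    · simpa [List.getD_eq_getElem?_getD] using hii
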